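/- The true conditional density minimizes the γ-cross entropy: if g(y|x) = f*(y|x) for almost every (x,y) with respect to g(x)dx⊗dy, and f(y|x) is any other conditional probability density such that all integrals appearing in d_γ are finite and positive, then d_γ(g(y|x), f*(y|x); g(x)) ≤ d_γ(g(y|x), f(y|x); g(x)). -/

import Mathlib

open MeasureTheory
open scoped ENNReal

/-- The double integral `∫∫ p(y|x) f(y|x)^γ w(x) dy dx` in `ℝ≥0∞`;
`J d γ f f w = ∫∫ f(y|x)^{1+γ} w(x) dy dx`. -/
noncomputable def J (d : ℕ) (γ : ℝ) (p f : (Fin d → ℝ) → ℝ → ℝ)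
    (w : (Fin d → ℝ) → ℝ) : ℝ≥0∞ :=
  ∫⁻ x : Fin d → ℝ,
    (∫⁻ y : ℝ, ENNReal.ofReal (p x y) * ENNReal.ofReal (f x y) ^ γ) *
      ENNReal.ofReal (w x)

/-- The γ-cross entropy for regression with base weight `w`:
`d_γ(p,f;w) = -(1/γ) log ∫∫ p f^γ w + (1/(1+γ)) log ∫∫ f^{1+γ} w`. -/
noncomputable def dgam (d : ℕ) (γ : ℝ) (p f : (Fin d → ℝ) → ℝ → ℝ)
    (w : (Fin d → ℝ) → ℝ) : ℝ :=
  -(1 / γ) * Real.log (J d γ p f w).toReal +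
    (1 / (1 + γ)) * Real.log (J d γ f f w).toReal

/-- The double integral `J` as an integral against the product measure `w(x)dx ⊗ dy`. -/
theorem J_eq_lintegral_prod {d : ℕ} {γ : ℝ} {p f : (Fin d → ℝ) → ℝ → ℝ} {w : (Fin d → ℝ) → ℝ}
    (hp : Measurable (Function.uncurry p)) (hf : Measurable (Function.uncurry f))
    (hw : Measurable w) :
    J d γ p f w =
      ∫⁻ z, ENNReal.ofReal (Function.uncurry p z) * ENNReal.ofReal (Function.uncurry f z) ^ γ
        ∂((volume.withDensity fun x => ENNReal.ofReal (w x)).prod (volume : Measure ℝ)) := by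
  have hm : Measurable fun z : (Fin d → ℝ) × ℝ =>
      ENNReal.ofReal (Function.uncurry p z) * ENNReal.ofReal (Function.uncurry f z) ^ γ :=
    hp.ennreal_ofReal.mul (hf.ennreal_ofReal.pow_const γ)
  rw [lintegral_prod _ hm.aemeasurable,
    lintegral_withDensity_eq_lintegral_mul _ hw.ennreal_ofReal hm.lintegral_prod_right']
  exact lintegral_congr fun x => mul_comm _ _

theorem lintegral_mul_rpow_le {α : Type*} [MeasurableSpace α] (μ : Measure α) {γ : ℝ}
    (hγ : 0 < γ) {u v : α → ℝ≥0∞} (hu : AEMeasurable u μ) (hv : AEMeasurable v μ) :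
    ∫⁻ a, u a * v a ^ γ ∂μ ≤
      (∫⁻ a, u a * u a ^ γ ∂μ) ^ (1 / (1 + γ)) * (∫⁻ a, v a * v a ^ γ ∂μ) ^ (γ / (1 + γ)) := by
  have hpq : (1 + γ).HolderConjugate ((1 + γ) / γ) := by
    rw [Real.holderConjugate_iff]
    refine ⟨by linarith, ?_⟩
    field_simp
  have hpow (t : ℝ≥0∞) : t * t ^ γ = t ^ (1 + γ) := by
    rw [ENNReal.rpow_add_of_nonneg _ _ zero_le_one hγ.le, ENNReal.rpow_one]
  have h := ENNReal.lintegral_mul_le_Lp_mul_Lq μ hpq hu (hv.pow_const γ)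
  simp only [Pi.mul_apply, ← ENNReal.rpow_mul, mul_div_cancel₀ _ hγ.ne', one_div_div] at h
  simpa only [hpow] using h

/-- The true conditional density minimizes the γ-cross entropy: if
`g(y|x) = f*(y|x)` a.e. w.r.t. `g(x)dx ⊗ dy`, then
`d_γ(g, f*; g(x)) ≤ d_γ(g, f; g(x))` for every other conditional density `f`
for which all the integrals appearing in `d_γ` are finite and positive. -/
theorem true_density_minimizes_gamma_cross_entropy {d : ℕ} {γ : ℝ} (hγ : 0 < γ)
    (g fstar f : (Fin d → ℝ) → ℝ → ℝ) (gx : (Fin d → ℝ) → ℝ)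
    (hg_meas : Measurable (Function.uncurry g))
    (hfstar_meas : Measurable (Function.uncurry fstar))
    (hf_meas : Measurable (Function.uncurry f))
    (hgx_meas : Measurable gx)
    (hg_nonneg : ∀ x y, 0 ≤ g x y) (hfstar_nonneg : ∀ x y, 0 ≤ fstar x y)
    (hf_nonneg : ∀ x y, 0 ≤ f x y) (hgx_nonneg : ∀ x, 0 ≤ gx x)
    (hg_dens : ∀ᵐ x : Fin d → ℝ ∂volume, ∫ y : ℝ, g x y = 1)
    (hfstar_dens : ∀ᵐ x : Fin d → ℝ ∂volume, ∫ y : ℝ, fstar x y = 1)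
    (hf_dens : ∀ᵐ x : Fin d → ℝ ∂volume, ∫ y : ℝ, f x y = 1)
    (hgx_int : Integrable gx) (hgx_prob : ∫ x : Fin d → ℝ, gx x = 1)
    -- g = f* a.e. with respect to g(x)dx ⊗ dy
    (hg_eq : ∀ᵐ p : (Fin d → ℝ) × ℝ
        ∂((volume.withDensity fun x => ENNReal.ofReal (gx x)).prod
          (volume : Measure ℝ)),
      g p.1 p.2 = fstar p.1 p.2)
    -- all integrals appearing in d_γ are finite and positive
    (hgfstar_pos : 0 < J d γ g fstar gx) (hgfstar_fin : J d γ g fstar gx ≠ ⊤)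
    (hfstar_pos : 0 < J d γ fstar fstar gx) (hfstar_fin : J d γ fstar fstar gx ≠ ⊤)
    (hgf_pos : 0 < J d γ g f gx) (hgf_fin : J d γ g f gx ≠ ⊤)
    (hff_pos : 0 < J d γ f f gx) (hff_fin : J d γ f f gx ≠ ⊤) :
    dgam d γ g fstar gx ≤ dgam d γ g f gx := by
  have hC : J d γ g f gx = J d γ fstar f gx := by
    rw [J_eq_lintegral_prod hg_meas hf_meas hgx_meas,
      J_eq_lintegral_prod hfstar_meas hf_meas hgx_meas]
    refine lintegral_congr_ae ?_
    filter_upwards [hg_eq] with z hz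
    simp only [Function.uncurry, hz]
  have hA : J d γ g fstar gx = J d γ fstar fstar gx := by
    rw [J_eq_lintegral_prod hg_meas hfstar_meas hgx_meas,
      J_eq_lintegral_prod hfstar_meas hfstar_meas hgx_meas]
    refine lintegral_congr_ae ?_
    filter_upwards [hg_eq] with z hz
    simp only [Function.uncurry, hz]
  have holder : J d γ g f gx ≤
      J d γ fstar fstar gx ^ (1 / (1 + γ)) * J d γ f f gx ^ (γ / (1 + γ)) := by
    rw [hC, J_eq_lintegral_prod hfstar_meas hf_meas hgx_meas,
      J_eq_lintegral_prod hfstar_meas hfstar_meas hgx_meas,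
      J_eq_lintegral_prod hf_meas hf_meas hgx_meas]
    exact lintegral_mul_rpow_le _ hγ hfstar_meas.ennreal_ofReal.aemeasurable
      hf_meas.ennreal_ofReal.aemeasurable
  have hA_pos := ENNReal.toReal_pos hfstar_pos.ne' hfstar_fin
  have hB_pos := ENNReal.toReal_pos hff_pos.ne' hff_fin
  have hC_pos := ENNReal.toReal_pos hgf_pos.ne' hgf_fin
  have hlog := Real.log_le_log hC_pos <| ENNReal.toReal_mono
    (ENNReal.mul_ne_top (ENNReal.rpow_ne_top_of_nonneg (by positivity) hfstar_fin)
      (ENNReal.rpow_ne_top_of_nonneg (by positivity) hff_fin)) holder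
  rw [ENNReal.toReal_mul, ← ENNReal.toReal_rpow, ← ENNReal.toReal_rpow,
    Real.log_mul (by positivity) (by positivity), Real.log_rpow hA_pos,
    Real.log_rpow hB_pos] at hlog
  unfold dgam
  rw [hA]
  have hscaled := mul_le_mul_of_nonneg_left hlog (one_div_pos.2 hγ).le
  have hcoef : 1 / γ * (1 / (1 + γ)) = 1 / γ - 1 / (1 + γ) := by
    field_simp
    ring
  have hcoef' : 1 / γ * (γ / (1 + γ)) = 1 / (1 + γ) := by
    field_simp
  rw [mul_add, ← mul_assoc, ← mul_assoc, hcoef, hcoef'] at hscaled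
  linarith
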